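/- Assume ‖·‖ is an admissible norm on ℝ³ and let f : M → ℝ³ be an immersed surface with Birkhoff normal field η and affine fundamental form h. A nonzero vector X ∈ T_pM is an asymptotic direction (i.e. h(X,X) = 0) if and only if the Minkowski normal curvature vanishes in that direction: k_{M,p}(X) = 0. -/

import Mathlib

/-!
Differential geometry of immersed surfaces in three-dimensional normed
(Minkowski) spaces, following Balestro–Martini–Teixeira.

`E3 = ℝ³` carries its standard Euclidean inner product and, in addition, a
norm `N` which is strictly convex and smooth.  Surfaces are given in a local
parametrization `f : P2 → E3` (an immersion on an open set `U`), endowed with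
a Birkhoff normal field `η`.
-/

noncomputable section

open scoped InnerProductSpace

abbrev E3 := EuclideanSpace ℝ (Fin 3)
abbrev P2 := EuclideanSpace ℝ (Fin 2)

/-- A smooth, strictly convex norm on `ℝ³` (a Minkowski norm). -/
structure MinkowskiNorm3 where
  N : E3 → ℝ
  nonneg : ∀ x, 0 ≤ N x
  eq_zero_iff : ∀ x, N x = 0 ↔ x = 0
  smul_eq : ∀ (c : ℝ) (x : E3), N (c • x) = |c| * N x
  triangle : ∀ x y, N (x + y) ≤ N x + N y
  strict_triangle : ∀ x y : E3, LinearIndependent ℝ ![x, y] → N (x + y) < N x + N y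
  smooth : ContDiffOn ℝ (⊤ : ℕ∞) N {x : E3 | x ≠ 0}

namespace MinkowskiNorm3

/-- Birkhoff orthogonality of a vector `v` to a set (e.g. a plane) `H`:
`‖v + w‖ ≥ ‖v‖` for all `w ∈ H`. -/
def BirkhoffOrth (m : MinkowskiNorm3) (v : E3) (H : Set E3) : Prop :=
  ∀ w ∈ H, m.N v ≤ m.N (v + w)

/-- The (outward) Euclidean Gauss map of the unit sphere `∂B` of the norm,
expressed on ambient space as the normalized gradient of `N`.  Restricted to
`∂B` it is the map `u⁻¹ : ∂B → ∂B_e`, whose inverse is `u : ∂B_e → ∂B`. -/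
def sphereGauss (m : MinkowskiNorm3) (v : E3) : E3 :=
  ‖gradient m.N v‖⁻¹ • gradient m.N v

/-- The differential `du⁻¹` at a point `v ∈ ∂B`, applied to a vector `w`
(its restriction to the tangent plane of `∂B` at `v` is the inverse of
`du_{u⁻¹(v)}`). -/
def duInv (m : MinkowskiNorm3) (v w : E3) : E3 :=
  fderiv ℝ m.sphereGauss v w

/-- Admissibility of the norm: the unit sphere `∂B` has positive Euclidean
Gaussian curvature at every point; equivalently, the second fundamental form
of `∂B` with respect to the outward normal is positive definite, i.e.
`⟪du⁻¹ w, w⟫ > 0` for every nonzero vector `w` tangent to `∂B`. -/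
def Admissible (m : MinkowskiNorm3) : Prop :=
  ∀ v : E3, m.N v = 1 → ∀ w : E3, w ≠ 0 → fderiv ℝ m.N v w = 0 →
    0 < ⟪m.duInv v w, w⟫_ℝ

end MinkowskiNorm3

/-- An immersed surface (in a local parametrization on an open set `U ⊆ ℝ²`)
in the Minkowski space `(ℝ³, m)`, endowed with a Birkhoff normal vector
field `η`: a smooth unit field with `η(p) ⊣_B T_pM` for all `p`. -/
structure BSurface (m : MinkowskiNorm3) where
  U : Set P2
  isOpen : IsOpen U
  f : P2 → E3
  smooth_f : ContDiffOn ℝ (⊤ : ℕ∞) f U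
  immersion : ∀ p ∈ U, Function.Injective (fderiv ℝ f p)
  η : P2 → E3
  smooth_η : ContDiffOn ℝ (⊤ : ℕ∞) η U
  unit_η : ∀ p ∈ U, m.N (η p) = 1
  birkhoff : ∀ p ∈ U, m.BirkhoffOrth (η p) (Set.range (fderiv ℝ f p))

namespace BSurface

variable {m : MinkowskiNorm3}

/-- The tangent plane `T_pM`, identified (via the push-forward `df_p`) with a
linear plane in ambient `ℝ³`. -/
def tangent (S : BSurface m) (p : P2) : Set E3 := Set.range (fderiv ℝ S.f p)

/-- `h : P2 → P2 → ℝ` (in the parameter coordinates, i.e. `h v w` stands for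
`h(df_p v, df_p w)`) is the affine fundamental form of the immersion at `p`,
determined by the Gauss formula `D_X Y = ∇_X Y + h(X,Y) η`: for coordinate
directions `v, w`, the second derivative `D_v D_w f` minus `h v w • η p` is
tangential. -/
def IsAffineFundForm (S : BSurface m) (p : P2) (h : P2 → P2 → ℝ) : Prop :=
  ∀ v w : P2,
    fderiv ℝ (fun q => fderiv ℝ S.f q w) p v - h v w • S.η p ∈ S.tangent p

end BSurface

/-- The Minkowski normal curvature of the surface parametrized by `f` with
Birkhoff normal field `η`, at `p`, in the tangent direction `X = df_p v`:
`k_{M,p}(X) = ⟪du⁻¹_{η(p)} X, dη_p X⟫ / ⟪du⁻¹_{η(p)} X, X⟫`, using the natural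
identification of the parallel planes `T_pM ≅ T_{η(p)}∂B ≅ T_{ξ(p)}∂B_e`. -/
def normalCurv (m : MinkowskiNorm3) (f η : P2 → E3) (p v : P2) : ℝ :=
  ⟪m.duInv (η p) (fderiv ℝ f p v), fderiv ℝ η p v⟫_ℝ /
    ⟪m.duInv (η p) (fderiv ℝ f p v), fderiv ℝ f p v⟫_ℝ

namespace MinkowskiNorm3

theorem ne_zero_of_apply_eq_one (m : MinkowskiNorm3) {v : E3} (hv : m.N v = 1) : v ≠ 0 := by
  rintro rfl
  rw [(m.eq_zero_iff 0).2 rfl] at hv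
  exact zero_ne_one hv

theorem contDiffAt (m : MinkowskiNorm3) {v : E3} (hv : v ≠ 0) :
    ContDiffAt ℝ (⊤ : ℕ∞) m.N v :=
  m.smooth.contDiffAt (isOpen_ne.mem_nhds hv)

theorem differentiableAt (m : MinkowskiNorm3) {v : E3} (hv : v ≠ 0) :
    DifferentiableAt ℝ m.N v :=
  (m.contDiffAt hv).differentiableAt (by simp)

theorem differentiableAt_fderiv (m : MinkowskiNorm3) {v : E3} (hv : v ≠ 0) :
    DifferentiableAt ℝ (fderiv ℝ m.N) v :=
  ((m.contDiffAt hv).fderiv_right (m := 1) (by norm_cast)).differentiableAt one_ne_zero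

/-- Euler's identity for the (positively homogeneous) norm. -/
theorem fderiv_apply_self (m : MinkowskiNorm3) {v : E3} (hv : v ≠ 0) :
    fderiv ℝ m.N v v = m.N v := by
  have hline : HasDerivAt (fun t : ℝ => t • v) v 1 := by
    simpa using (hasDerivAt_id (1 : ℝ)).smul_const v
  have hN : HasFDerivAt m.N (fderiv ℝ m.N v) ((1 : ℝ) • v) := by
    simpa using (m.differentiableAt hv).hasFDerivAt
  have hcomp : HasDerivAt (fun t : ℝ => m.N (t • v)) (fderiv ℝ m.N v v) 1 :=
    hN.comp_hasDerivAt 1 hline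
  have hlin : HasDerivAt (fun t : ℝ => m.N (t • v)) (m.N v) 1 := by
    have hmul : HasDerivAt (fun t : ℝ => t * m.N v) (m.N v) 1 := by
      simpa using (hasDerivAt_id (1 : ℝ)).mul_const (m.N v)
    refine hmul.congr_of_eventuallyEq ?_
    filter_upwards [lt_mem_nhds (zero_lt_one (α := ℝ))] with t ht
    rw [m.smul_eq, abs_of_pos ht]
  exact hcomp.unique hlin

/-- The derivative of the norm at a vector Birkhoff orthogonal to a line vanishes along that line. -/
theorem fderiv_eq_zero_of_le (m : MinkowskiNorm3) {v w : E3} (hv : v ≠ 0)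
    (hle : ∀ t : ℝ, m.N v ≤ m.N (v + t • w)) : fderiv ℝ m.N v w = 0 := by
  have hline : HasDerivAt (fun t : ℝ => v + t • w) w 0 := by
    simpa using ((hasDerivAt_id (0 : ℝ)).smul_const w).const_add v
  have hN : HasFDerivAt m.N (fderiv ℝ m.N v) (v + (0 : ℝ) • w) := by
    simpa using (m.differentiableAt hv).hasFDerivAt
  have hcomp : HasDerivAt (fun t : ℝ => m.N (v + t • w)) (fderiv ℝ m.N v w) 0 :=
    hN.comp_hasDerivAt 0 hline
  have hmin : IsLocalMin (fun t : ℝ => m.N (v + t • w)) 0 :=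
    Filter.Eventually.of_forall fun t => by simpa using hle t
  exact hmin.hasDerivAt_eq_zero hcomp

theorem inner_gradient (m : MinkowskiNorm3) (v w : E3) :
    ⟪gradient m.N v, w⟫_ℝ = fderiv ℝ m.N v w := by
  simp [gradient]

theorem inner_sphereGauss (m : MinkowskiNorm3) (v w : E3) :
    ⟪m.sphereGauss v, w⟫_ℝ = ‖gradient m.N v‖⁻¹ * fderiv ℝ m.N v w := by
  rw [sphereGauss, real_inner_smul_left, inner_gradient]

theorem gradient_ne_zero (m : MinkowskiNorm3) {v : E3} (hv : v ≠ 0) :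
    gradient m.N v ≠ 0 := by
  intro h0
  have h1 := m.inner_gradient v v
  rw [h0, inner_zero_left, m.fderiv_apply_self hv] at h1
  exact hv ((m.eq_zero_iff v).1 h1.symm)

theorem differentiableAt_gradient (m : MinkowskiNorm3) {v : E3} (hv : v ≠ 0) :
    DifferentiableAt ℝ (gradient m.N) v :=
  ((InnerProductSpace.toDual ℝ E3).symm.toContinuousLinearEquiv.differentiableAt).comp v
    (m.differentiableAt_fderiv hv)

theorem differentiableAt_inv_norm_gradient (m : MinkowskiNorm3) {v : E3} (hv : v ≠ 0) :
    DifferentiableAt ℝ (fun u => ‖gradient m.N u‖⁻¹) v :=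
  ((m.differentiableAt_gradient hv).norm ℝ (m.gradient_ne_zero hv)).inv
    (norm_ne_zero_iff.2 (m.gradient_ne_zero hv))

theorem differentiableAt_sphereGauss (m : MinkowskiNorm3) {v : E3} (hv : v ≠ 0) :
    DifferentiableAt ℝ m.sphereGauss v :=
  (m.differentiableAt_inv_norm_gradient hv).smul (m.differentiableAt_gradient hv)

/-- Along tangent vectors, `du⁻¹` is the Hessian of the norm divided by the length of its
gradient. -/
theorem inner_duInv (m : MinkowskiNorm3) {v : E3} (hv : v ≠ 0) (w : E3) {y : E3}
    (hy : fderiv ℝ m.N v y = 0) :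
    ⟪m.duInv v w, y⟫_ℝ = ‖gradient m.N v‖⁻¹ * fderiv ℝ (fderiv ℝ m.N) v w y := by
  have hinner := (m.differentiableAt_sphereGauss hv).hasFDerivAt.inner ℝ (hasFDerivAt_const y v)
  have hprod := (m.differentiableAt_inv_norm_gradient hv).hasFDerivAt.mul
    ((m.differentiableAt_fderiv hv).hasFDerivAt.clm_apply (hasFDerivAt_const y v))
  have heq := DFunLike.congr_fun
    (hinner.unique (hprod.congr_of_eventuallyEq
      (Filter.Eventually.of_forall fun u => m.inner_sphereGauss u y))) w
  simpa [duInv, fderivInnerCLM_apply, hy] using heq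

theorem inner_duInv_comm (m : MinkowskiNorm3) {v : E3} (hv : v ≠ 0) {w y : E3}
    (hw : fderiv ℝ m.N v w = 0) (hy : fderiv ℝ m.N v y = 0) :
    ⟪m.duInv v w, y⟫_ℝ = ⟪m.duInv v y, w⟫_ℝ := by
  have hsymm : IsSymmSndFDerivAt ℝ m.N v :=
    (m.contDiffAt hv).isSymmSndFDerivAt (by
      simp only [minSmoothness_of_isRCLikeNormedField]
      norm_cast)
  rw [m.inner_duInv hv w hy, m.inner_duInv hv y hw, hsymm.eq]

end MinkowskiNorm3

namespace BSurface

variable {m : MinkowskiNorm3}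

theorem η_ne_zero (S : BSurface m) {p : P2} (hp : p ∈ S.U) : S.η p ≠ 0 :=
  m.ne_zero_of_apply_eq_one (S.unit_η p hp)

theorem differentiableAt_η (S : BSurface m) {p : P2} (hp : p ∈ S.U) :
    DifferentiableAt ℝ S.η p :=
  (S.smooth_η.contDiffAt (S.isOpen.mem_nhds hp)).differentiableAt (by simp)

theorem differentiableAt_fderiv_apply (S : BSurface m) {p : P2} (hp : p ∈ S.U) (v : P2) :
    DifferentiableAt ℝ (fun q => fderiv ℝ S.f q v) p :=
  (((S.smooth_f.contDiffAt (S.isOpen.mem_nhds hp)).fderiv_right (m := 1)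
    (by norm_cast)).differentiableAt one_ne_zero).clm_apply (differentiableAt_const v)

theorem fderiv_norm_eq_zero_of_mem_tangent (S : BSurface m) {p : P2} (hp : p ∈ S.U) {w : E3}
    (hw : w ∈ S.tangent p) : fderiv ℝ m.N (S.η p) w = 0 := by
  obtain ⟨v, rfl⟩ := hw
  refine m.fderiv_eq_zero_of_le (S.η_ne_zero hp) fun t => ?_
  exact S.birkhoff p hp _ ⟨t • v, map_smul _ t v⟩

theorem fderiv_norm_fderiv_η (S : BSurface m) {p : P2} (hp : p ∈ S.U) (v : P2) :
    fderiv ℝ m.N (S.η p) (fderiv ℝ S.η p v) = 0 := by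
  have hcomp := (m.differentiableAt (S.η_ne_zero hp)).hasFDerivAt.comp p
    (S.differentiableAt_η hp).hasFDerivAt
  have hconst : HasFDerivAt (m.N ∘ S.η) (0 : P2 →L[ℝ] ℝ) p := by
    refine (hasFDerivAt_const (1 : ℝ) p).congr_of_eventuallyEq ?_
    filter_upwards [S.isOpen.mem_nhds hp] with q hq using S.unit_η q hq
  exact DFunLike.congr_fun (hcomp.unique hconst) v

/-- Differentiating the orthogonality of `u⁻¹ ∘ η` to the tangent planes. -/
theorem inner_duInv_fderiv_η (S : BSurface m) {p : P2} (hp : p ∈ S.U) (v w : P2) :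
    ⟪m.duInv (S.η p) (fderiv ℝ S.η p v), fderiv ℝ S.f p w⟫_ℝ =
      -⟪m.sphereGauss (S.η p), fderiv ℝ (fun q => fderiv ℝ S.f q w) p v⟫_ℝ := by
  have hξ : HasFDerivAt (fun q => m.sphereGauss (S.η q))
      ((fderiv ℝ m.sphereGauss (S.η p)).comp (fderiv ℝ S.η p)) p :=
    (m.differentiableAt_sphereGauss (S.η_ne_zero hp)).hasFDerivAt.comp p
      (S.differentiableAt_η hp).hasFDerivAt
  have hinner := hξ.inner ℝ (S.differentiableAt_fderiv_apply hp w).hasFDerivAt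
  have hzero : HasFDerivAt (fun q => ⟪m.sphereGauss (S.η q), fderiv ℝ S.f q w⟫_ℝ)
      (0 : P2 →L[ℝ] ℝ) p := by
    refine (hasFDerivAt_const (0 : ℝ) p).congr_of_eventuallyEq ?_
    filter_upwards [S.isOpen.mem_nhds hp] with q hq
    rw [m.inner_sphereGauss, S.fderiv_norm_eq_zero_of_mem_tangent hq ⟨w, rfl⟩, mul_zero]
  have h0 := DFunLike.congr_fun (hinner.unique hzero) v
  simp only [fderivInnerCLM_apply, ContinuousLinearMap.comp_apply, ContinuousLinearMap.prod_apply,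
    zero_apply] at h0
  rw [MinkowskiNorm3.duInv]
  linarith

theorem IsAffineFundForm.inner_sphereGauss {S : BSurface m} {p : P2} {h : P2 → P2 → ℝ}
    (hh : S.IsAffineFundForm p h) (hp : p ∈ S.U) (v w : P2) :
    ⟪m.sphereGauss (S.η p), fderiv ℝ (fun q => fderiv ℝ S.f q w) p v⟫_ℝ =
      ‖gradient m.N (S.η p)‖⁻¹ * h v w := by
  have h0 := S.fderiv_norm_eq_zero_of_mem_tangent hp (hh v w)
  rw [map_sub, map_smul, m.fderiv_apply_self (S.η_ne_zero hp), S.unit_η p hp, smul_eq_mul,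
    mul_one, sub_eq_zero] at h0
  rw [m.inner_sphereGauss, h0]

end BSurface

/-- A nonzero tangent vector `X = df_p v` is an asymptotic
direction (`h(X,X) = 0`) if and only if the Minkowski normal curvature
vanishes in that direction. -/
theorem asymptotic_iff_normal_curvature_zero (m : MinkowskiNorm3)
    (hadm : m.Admissible) (S : BSurface m) (p : P2) (hp : p ∈ S.U)
    (h : P2 → P2 → ℝ) (hh : S.IsAffineFundForm p h)
    (v : P2) (hv : v ≠ 0) :
    h v v = 0 ↔ normalCurv m S.f S.η p v = 0 := by
  have hη := S.η_ne_zero hp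
  have hX : fderiv ℝ m.N (S.η p) (fderiv ℝ S.f p v) = 0 :=
    S.fderiv_norm_eq_zero_of_mem_tangent hp ⟨v, rfl⟩
  have hX0 : fderiv ℝ S.f p v ≠ 0 := fun h0 =>
    hv (S.immersion p hp (h0.trans (map_zero _).symm))
  have hden := hadm _ (S.unit_η p hp) _ hX0 hX
  have hgrad : ‖gradient m.N (S.η p)‖⁻¹ ≠ 0 :=
    inv_ne_zero (norm_ne_zero_iff.2 (m.gradient_ne_zero hη))
  rw [normalCurv, div_eq_zero_iff, or_iff_left hden.ne',
    m.inner_duInv_comm hη hX (S.fderiv_norm_fderiv_η hp v), S.inner_duInv_fderiv_η hp,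
    hh.inner_sphereGauss hp, neg_eq_zero, mul_eq_zero, or_iff_right hgrad]
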